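/- Let (a_g)_{g≥1} be a sequence of positive real numbers satisfying the volume recursion. Then a_g = (2g−2)!·b_g + O((2g−2)!·b_g/g) as g → ∞; that is, there exist C > 0 and g_0 such that for all g ≥ g_0, |a_g − (2g−2)!·b_g| ≤ C·(2g−2)!·b_g/g. -/

import Mathlib

open Finset Real

noncomputable section

/-- `b_g = ((2^(2g-1) - 1)/2^(2g-1)) · |B_{2g}|/(2g)!` for `g ≥ 1`, and `b_0 = 1`. -/
def bSeq (g : ℕ) : ℚ :=
  if g = 0 then 1
  else ((2 ^ (2 * g - 1) - 1) / 2 ^ (2 * g - 1)) * |bernoulli (2 * g)| /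
    (Nat.factorial (2 * g) : ℚ)

/-- The sequence `b_g` viewed as real numbers. -/
def bR (g : ℕ) : ℝ := (bSeq g : ℝ)

/-- The sum over ordered `k`-tuples of positive integers with sum `g` of
`∏_j (2 d_j - 1) a_{d_j}`. -/
def tupleSum (a : ℕ → ℝ) (k g : ℕ) : ℝ :=
  ∑ d ∈ (Finset.Nat.antidiagonalTuple k g).filter (fun d => ∀ j, 0 < d j),
    ∏ j, ((2 * (d j : ℝ) - 1) * a (d j))

/-- The volume recursion for a sequence `(a_g)_{g ≥ 1}`:
`b_g = Σ_{k=1}^{g} (1/(k!·(2g−k)!)) · Σ_{d_1+⋯+d_k=g} ∏ (2d_j−1)·a_{d_j}`. -/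
def VolumeRecursion (a : ℕ → ℝ) : Prop :=
  ∀ g : ℕ, 1 ≤ g →
    bR g = ∑ k ∈ Finset.Icc 1 g,
      (1 / ((Nat.factorial k * Nat.factorial (2 * g - k) : ℕ) : ℝ)) * tupleSum a k g

/-- The Siegel–Veech recursion for `(d_g)_{g ≥ 1}` relative to `(a_g)_{g ≥ 1}`:
`b_{g−1}/2 = Σ_{g'=1}^{g} Σ_{k=0}^{g−g'} ((2g'−1)·d_{g'}/(k!·(2g−1−k)!)) ·
Σ_{g_1+⋯+g_k=g−g'} ∏ (2g_i−1)·a_{g_i}`. -/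
def SVRecursion (a d : ℕ → ℝ) : Prop :=
  ∀ g : ℕ, 1 ≤ g →
    bR (g - 1) / 2 =
      ∑ g' ∈ Finset.Icc 1 g, ∑ k ∈ Finset.range (g - g' + 1),
        ((2 * (g' : ℝ) - 1) * d g' /
          ((Nat.factorial k * Nat.factorial (2 * g - 1 - k) : ℕ) : ℝ)) *
          tupleSum a k (g - g')

lemma factorial_mul_factorial_le_two_mul (m n : ℕ) :
    (m + 2).factorial * (n + 2).factorial ≤ 2 * (m + n + 2).factorial := by
  induction m with
  | zero => simp
  | succ m ih =>
    rw [show m + 1 + 2 = (m + 2) + 1 by ring, show m + 1 + n + 2 = (m + n + 2) + 1 by ring,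
      Nat.factorial_succ, Nat.factorial_succ (m + n + 2)]
    calc (m + 2 + 1) * (m + 2).factorial * (n + 2).factorial
        = (m + 2 + 1) * ((m + 2).factorial * (n + 2).factorial) := by ring
      _ ≤ (m + n + 2 + 1) * (2 * (m + n + 2).factorial) := by gcongr; omega
      _ = 2 * ((m + n + 2 + 1) * (m + n + 2).factorial) := by ring

lemma sum_factorial_mul_factorial_le (N : ℕ) :
    ∑ p ∈ Ico 1 N, p.factorial * (N - p).factorial ≤ 4 * (N - 1).factorial := by
  match N with
  | 0 => simp
  | 1 => simp
  | 2 => simp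
  | M + 3 =>
    have h : ∑ p ∈ Ico 2 (M + 2), p.factorial * (M + 3 - p).factorial ≤
        M * (2 * (M + 1).factorial) := by
      refine (sum_le_card_nsmul _ _ (2 * (M + 1).factorial) fun p hp => ?_).trans (by simp)
      obtain ⟨h1, h2⟩ := mem_Ico.mp hp
      have := factorial_mul_factorial_le_two_mul (p - 2) (M + 1 - p)
      rwa [show p - 2 + 2 = p by omega, show M + 1 - p + 2 = M + 3 - p by omega,
        show p - 2 + (M + 1 - p) + 2 = M + 1 by omega] at this
    rw [sum_Ico_succ_top (by omega), sum_eq_sum_Ico_succ_bot (by omega),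
      show M + 3 - (M + 2) = 1 by omega, show M + 3 - 1 = M + 2 by omega]
    have e : (M + 2).factorial = (M + 2) * (M + 1).factorial := Nat.factorial_succ _
    simp only [Nat.factorial_one, one_mul, mul_one]
    norm_num at h ⊢
    nlinarith [Nat.zero_le (M + 1).factorial]

lemma tupleSum_nonneg {a : ℕ → ℝ} (ha : ∀ g, 1 ≤ g → 0 < a g) (k g : ℕ) :
    0 ≤ tupleSum a k g := by
  refine sum_nonneg fun d hd => prod_nonneg fun j _ => ?_
  have hj : 1 ≤ d j := (mem_filter.mp hd).2 j
  have hj' : (1 : ℝ) ≤ d j := by exact_mod_cast hj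
  exact mul_nonneg (by linarith) (ha _ hj).le

lemma tupleSum_eq_zero_of_lt (a : ℕ → ℝ) {k g : ℕ} (h : g < k) : tupleSum a k g = 0 := by
  refine sum_eq_zero fun d hd => ?_
  obtain ⟨h1, h2⟩ := mem_filter.mp hd
  rw [Finset.Nat.mem_antidiagonalTuple] at h1
  have : ∑ _j : Fin k, 1 ≤ ∑ j, d j := sum_le_sum fun j _ => h2 j
  simp at this
  omega

lemma tupleSum_succ (a : ℕ → ℝ) (k g : ℕ) :
    tupleSum a (k + 1) g =
      ∑ i ∈ Icc 1 g, (2 * (i : ℝ) - 1) * a i * tupleSum a k (g - i) := by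
  simp only [tupleSum, mul_sum]
  rw [sum_sigma']
  refine sum_bij' (fun d _ => ⟨d 0, Fin.tail d⟩) (fun p _ => Fin.cons p.1 p.2) ?_ ?_ ?_ ?_ ?_
  · intro d hd
    simp only [mem_filter, Finset.Nat.mem_antidiagonalTuple, Fin.sum_univ_succ, mem_sigma,
      mem_Icc, Fin.tail] at hd ⊢
    exact ⟨⟨hd.2 0, by omega⟩, by omega, fun j => hd.2 _⟩
  · rintro ⟨i, d⟩ hd
    simp only [mem_filter, Finset.Nat.mem_antidiagonalTuple, Fin.sum_univ_succ, mem_sigma,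
      mem_Icc, Fin.cons_zero, Fin.cons_succ, Fin.forall_fin_succ] at hd ⊢
    exact ⟨by omega, by omega, hd.2.2⟩
  · intro d _
    simp
  · rintro ⟨i, d⟩ _
    simp
  · intro d _
    simp [Fin.prod_univ_succ, Fin.tail]

lemma tupleSum_one (a : ℕ → ℝ) {g : ℕ} (hg : 1 ≤ g) :
    tupleSum a 1 g = (2 * (g : ℝ) - 1) * a g := by
  rw [tupleSum, Finset.Nat.antidiagonalTuple_one, filter_true_of_mem (by simpa using Nat.pos_of_ne_zero (by omega))]
  simp

lemma mul_tupleSum_le_of_forall_le {a : ℕ → ℝ} {K r : ℝ} (ha : ∀ g, 1 ≤ g → 0 < a g)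
    (hK : 0 ≤ K) (hr : 0 ≤ r)
    (hw : ∀ g : ℕ, 1 ≤ g → (2 * (g : ℝ) - 1) * a g ≤ K * r ^ g * (2 * g - 1).factorial) {k : ℕ}
    (ih : ∀ g, k + 1 ≤ g →
      tupleSum a (k + 1) g ≤ K ^ (k + 1) * 4 ^ k * r ^ g * (2 * g - (k + 1)).factorial)
    {g : ℕ} (hg : k + 2 ≤ g) :
    g * tupleSum a (k + 2) g ≤
      K ^ (k + 2) * 4 ^ (k + 1) * r ^ g * (2 * g - (k + 2)).factorial := by
  set N := 2 * g - (k + 2) with hN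
  have hsub : Icc 1 (g - (k + 1)) ⊆ Icc 1 g := Icc_subset_Icc_right (by omega)
  have hsum : ∑ i ∈ Icc 1 (g - (k + 1)), (2 * i - 1).factorial * (N - (2 * i - 1)).factorial ≤
      4 * (N - 1).factorial := by
    refine le_trans ?_ (sum_factorial_mul_factorial_le N)
    rw [← sum_image (f := fun p => p.factorial * (N - p).factorial) (g := fun i => 2 * i - 1)]
    · refine sum_le_sum_of_subset fun p hp => ?_
      obtain ⟨i, hi, rfl⟩ := mem_image.mp hp
      rw [mem_Icc] at hi
      rw [mem_Ico]
      omega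
    · intro i hi j hj hij
      simp only [coe_Icc, Set.mem_Icc] at hi hj hij
      omega
  have hmul : g * (4 * (N - 1).factorial) ≤ 4 * N.factorial := by
    rw [← Nat.mul_factorial_pred (show N ≠ 0 by omega)]
    calc g * (4 * (N - 1).factorial) ≤ N * (4 * (N - 1).factorial) := by gcongr; omega
      _ = _ := by ring
  have hbound : tupleSum a (k + 2) g ≤ K ^ (k + 2) * 4 ^ k * r ^ g *
      ((∑ i ∈ Icc 1 (g - (k + 1)),
        (2 * i - 1).factorial * (N - (2 * i - 1)).factorial : ℕ) : ℝ) := by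
    rw [tupleSum_succ, ← sum_subset hsub]
    · push_cast
      rw [mul_sum]
      refine sum_le_sum fun i hi => ?_
      rw [mem_Icc] at hi
      calc (2 * (i : ℝ) - 1) * a i * tupleSum a (k + 1) (g - i)
          ≤ (K * r ^ i * (2 * i - 1).factorial) *
            (K ^ (k + 1) * 4 ^ k * r ^ (g - i) * (2 * (g - i) - (k + 1)).factorial) :=
            mul_le_mul (hw i hi.1) (ih _ (by omega)) (tupleSum_nonneg ha _ _) (by positivity)
        _ = _ := by
          rw [← pow_mul_pow_sub r (show i ≤ g by omega),
            show 2 * (g - i) - (k + 1) = N - (2 * i - 1) by omega]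
          ring
    · intro i hi hi'
      rw [mem_Icc] at hi hi'
      rw [tupleSum_eq_zero_of_lt a (by omega), mul_zero]
  calc (g : ℝ) * tupleSum a (k + 2) g
      ≤ g * (K ^ (k + 2) * 4 ^ k * r ^ g * ((4 * (N - 1).factorial : ℕ) : ℝ)) := by
        refine mul_le_mul_of_nonneg_left (hbound.trans ?_) (by positivity)
        gcongr
    _ = K ^ (k + 2) * 4 ^ k * r ^ g * ((g * (4 * (N - 1).factorial) : ℕ) : ℝ) := by
        push_cast; ring
    _ ≤ K ^ (k + 2) * 4 ^ k * r ^ g * ((4 * N.factorial : ℕ) : ℝ) := by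
        gcongr
    _ = _ := by push_cast; ring

lemma tupleSum_succ_le {a : ℕ → ℝ} {K r : ℝ} (ha : ∀ g, 1 ≤ g → 0 < a g)
    (hK : 0 ≤ K) (hr : 0 ≤ r)
    (hw : ∀ g : ℕ, 1 ≤ g → (2 * (g : ℝ) - 1) * a g ≤ K * r ^ g * (2 * g - 1).factorial) (k : ℕ) :
    ∀ g, k + 1 ≤ g →
      tupleSum a (k + 1) g ≤ K ^ (k + 1) * 4 ^ k * r ^ g * (2 * g - (k + 1)).factorial := by
  induction k with
  | zero =>
    intro g hg
    rw [tupleSum_one a hg]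
    simpa using hw g hg
  | succ k ih =>
    intro g hg
    have hg' : (1 : ℝ) ≤ g := by exact_mod_cast (by omega : 1 ≤ g)
    exact (le_mul_of_one_le_left (tupleSum_nonneg ha _ _) hg').trans
      (mul_tupleSum_le_of_forall_le ha hK hr hw ih hg)

lemma bR_bounds {g : ℕ} (hg : 1 ≤ g) :
    ((2 * π) ^ 2)⁻¹ ^ g ≤ bR g ∧ bR g ≤ 4 * ((2 * π) ^ 2)⁻¹ ^ g := by
  have hz := hasSum_zeta_nat (show g ≠ 0 by omega)
  set Z := (-1 : ℝ) ^ (g + 1) * (2 : ℝ) ^ (2 * g - 1) * π ^ (2 * g) *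
    bernoulli (2 * g) / (2 * g).factorial with hZ
  have hZ1 : 1 ≤ Z := by
    simpa using le_hasSum hz 1 fun n _ => by positivity
  have hZ2 : Z ≤ 2 := by
    have h : Z ≤ π ^ 2 / 6 := by
      refine hasSum_le (fun n => ?_) hz hasSum_zeta_two
      rcases Nat.eq_zero_or_pos n with rfl | hn
      · simp [show g ≠ 0 by omega]
      · have hn' : (1 : ℝ) ≤ n := by exact_mod_cast hn
        gcongr
        · omega
    nlinarith [pi_lt_d2, pi_pos]
  have hB : |(bernoulli (2 * g) : ℝ)| / (2 * g).factorial =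
      Z / (2 ^ (2 * g - 1) * π ^ (2 * g)) := by
    rw [← abs_of_nonneg (zero_le_one.trans hZ1), hZ]
    simp only [abs_mul, abs_div, abs_pow, abs_neg, abs_one, one_pow, one_mul, Nat.abs_cast,
      Nat.abs_ofNat, abs_of_pos pi_pos]
    field_simp
  obtain ⟨m, rfl⟩ : ∃ m, g = m + 1 := ⟨g - 1, by omega⟩
  have hb : bR (m + 1) =
      (2 * (1 - ((2 : ℝ) ^ (2 * m + 1))⁻¹) * Z) * ((2 * π) ^ 2)⁻¹ ^ (m + 1) := by
    rw [bR, bSeq, if_neg (by omega)]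
    push_cast
    rw [mul_div_assoc, hB, show 2 * (m + 1) - 1 = 2 * m + 1 by omega]
    rw [inv_pow, ← pow_mul, mul_pow, show 2 * (m + 1) = (2 * m + 1) + 1 by ring]
    field_simp
    ring
  have hp : (0 : ℝ) ≤ ((2 * π) ^ 2)⁻¹ ^ (m + 1) := by positivity
  have h2 : (2 : ℝ) ≤ 2 ^ (2 * m + 1) := le_self_pow₀ (by norm_num) (by omega)
  have h3 : ((2 : ℝ) ^ (2 * m + 1))⁻¹ ≤ 2⁻¹ := inv_anti₀ (by norm_num) h2
  have h4 : 0 < ((2 : ℝ) ^ (2 * m + 1))⁻¹ := by positivity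
  rw [hb]
  exact ⟨le_mul_of_one_le_left hp (by nlinarith), mul_le_mul_of_nonneg_right (by nlinarith) hp⟩

lemma VolumeRecursion.bR_eq {a : ℕ → ℝ} (ha : VolumeRecursion a) {g : ℕ} (hg : 1 ≤ g) :
    bR g = a g / (2 * g - 2).factorial + ∑ k ∈ Ico 2 (g + 1),
      (1 / ((Nat.factorial k * Nat.factorial (2 * g - k) : ℕ) : ℝ)) * tupleSum a k g := by
  rw [ha g hg, ← Ico_add_one_right_eq_Icc, sum_eq_sum_Ico_succ_bot (by omega), tupleSum_one a hg]
  congr 1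
  obtain ⟨m, rfl⟩ : ∃ m, g = m + 1 := ⟨g - 1, by omega⟩
  rw [show 2 * (m + 1) - 1 = 2 * m + 1 by omega, show 2 * (m + 1) - 2 = 2 * m by omega,
    Nat.factorial_succ (2 * m)]
  push_cast
  have : (2 * (m : ℝ) + 1) ≠ 0 := by positivity
  simp only [Nat.factorial_one, Nat.cast_one, one_mul]
  field_simp
  ring

theorem stmt12 (a : ℕ → ℝ) (hapos : ∀ g : ℕ, 1 ≤ g → 0 < a g)
    (ha : VolumeRecursion a) :
    ∃ C > (0 : ℝ), ∃ g0 : ℕ, ∀ g : ℕ, g0 ≤ g →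
      |a g - (Nat.factorial (2 * g - 2) : ℝ) * bR g| ≤
        C * ((Nat.factorial (2 * g - 2) : ℝ) * bR g) / (g : ℝ) := by
  set r : ℝ := ((2 * π) ^ 2)⁻¹ with hr
  have hr0 : 0 ≤ r := by positivity
  have hterm (g k : ℕ) :
      0 ≤ (1 / ((Nat.factorial k * Nat.factorial (2 * g - k) : ℕ) : ℝ)) * tupleSum a k g :=
    mul_nonneg (by positivity) (tupleSum_nonneg hapos _ _)
  have hw (g : ℕ) (hg : 1 ≤ g) :
      (2 * (g : ℝ) - 1) * a g ≤ 4 * r ^ g * (2 * g - 1).factorial := by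
    have hle : a g / (2 * g - 2).factorial ≤ 4 * r ^ g := by
      refine le_trans ?_ (bR_bounds hg).2
      rw [ha.bR_eq hg]
      exact le_add_of_nonneg_right (sum_nonneg fun k _ => hterm g k)
    rw [div_le_iff₀ (by positivity)] at hle
    obtain ⟨m, rfl⟩ : ∃ m, g = m + 1 := ⟨g - 1, by omega⟩
    rw [show 2 * (m + 1) - 2 = 2 * m by omega] at hle
    rw [show 2 * (m + 1) - 1 = 2 * m + 1 by omega, Nat.factorial_succ]
    push_cast
    calc (2 * ((m : ℝ) + 1) - 1) * a (m + 1) = (2 * m + 1) * a (m + 1) := by ring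
      _ ≤ (2 * m + 1) * (4 * r ^ (m + 1) * (2 * m).factorial) := by gcongr
      _ = _ := by ring
  refine ⟨exp 16, exp_pos _, 1, fun g hg => ?_⟩
  have hg0 : (0 : ℝ) < g := by exact_mod_cast hg
  set R := ∑ k ∈ Ico 2 (g + 1),
    (1 / ((Nat.factorial k * Nat.factorial (2 * g - k) : ℕ) : ℝ)) * tupleSum a k g with hR
  have hR0 : 0 ≤ R := sum_nonneg fun k _ => hterm g k
  have hRle : g * R ≤ exp 16 * bR g := by
    calc g * R ≤ ∑ k ∈ Ico 2 (g + 1), r ^ g * (16 ^ k / k.factorial) := by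
          rw [hR, mul_sum]
          refine sum_le_sum fun k hk => ?_
          obtain ⟨hk2, hkg⟩ := mem_Ico.mp hk
          obtain ⟨j, rfl⟩ : ∃ j, k = j + 2 := ⟨k - 2, by omega⟩
          have h := mul_tupleSum_le_of_forall_le hapos zero_le_four hr0 hw
            (tupleSum_succ_le hapos zero_le_four hr0 hw j) (show j + 2 ≤ g by omega)
          push_cast
          calc (g : ℝ) * (1 / ((j + 2).factorial * (2 * g - (j + 2)).factorial) *
                tupleSum a (j + 2) g)
              = (g * tupleSum a (j + 2) g) /
                ((j + 2).factorial * (2 * g - (j + 2)).factorial) := by ring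
            _ ≤ (4 ^ (j + 2) * 4 ^ (j + 1) * r ^ g * (2 * g - (j + 2)).factorial) /
                ((j + 2).factorial * (2 * g - (j + 2)).factorial) := by gcongr
            _ = r ^ g * ((4 ^ (j + 2) * 4 ^ (j + 1)) / (j + 2).factorial) := by field_simp
            _ ≤ r ^ g * (16 ^ (j + 2) / (j + 2).factorial) := by
                gcongr
                rw [show (16 : ℝ) = 4 * 4 by norm_num, mul_pow]
                gcongr <;> norm_num
      _ ≤ ∑ k ∈ range (g + 1), r ^ g * (16 ^ k / k.factorial) := by
          refine sum_le_sum_of_subset_of_nonneg ?_ fun k _ _ => by positivity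
          intro k hk
          exact mem_range.mpr (mem_Ico.mp hk).2
      _ = r ^ g * ∑ k ∈ range (g + 1), (16 : ℝ) ^ k / k.factorial := by rw [mul_sum]
      _ ≤ bR g * exp 16 := by
          refine mul_le_mul (bR_bounds hg).1 (sum_le_exp_of_nonneg (by norm_num) _)
            (sum_nonneg fun k _ => by positivity) ((pow_nonneg hr0 g).trans (bR_bounds hg).1)
      _ = exp 16 * bR g := mul_comm _ _
  have hdiff : a g - (2 * g - 2).factorial * bR g = -((2 * g - 2).factorial * R) := by
    rw [ha.bR_eq hg, ← hR]
    field_simp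
    ring
  rw [hdiff, abs_neg, abs_of_nonneg (by positivity), le_div_iff₀ hg0]
  calc (2 * g - 2).factorial * R * g = (2 * g - 2).factorial * (g * R) := by ring
    _ ≤ (2 * g - 2).factorial * (exp 16 * bR g) := by gcongr
    _ = _ := by ring
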